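/- Let χ̂_{A_n}(q) denote the modified characteristic polynomial of the Coxeter group A_n (the symmetric group 𝔖_{n+1}) under the left weak order, with χ̂_{A_0}(q) = 1. Then, as formal power series in x with coefficients polynomials in q, (Σ_{n≥0} χ̂_{A_n}(q) x^n) · (Σ_{n≥0} (−1)^n q^{C(n,2)} x^n) = Σ_{n≥0} (−1)^n q^{C(n+1,2)} x^n. -/

import Mathlib

open Polynomial

namespace CoxeterCharPoly

variable {B W : Type*} [Group W] {M : CoxeterMatrix B}

/-- The left weak order on a Coxeter group. -/
def wle (cs : CoxeterSystem M W) (u w : W) : Prop :=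
  cs.length w = cs.length (w * u⁻¹) + cs.length u

/-- The standard parabolic subgroup generated by `J ⊆ S`. -/
def parabolic (cs : CoxeterSystem M W) (J : Set B) : Subgroup W :=
  Subgroup.closure (cs.simple '' J)

/- The longest element of the parabolic subgroup `W_J` (junk value if there is
no element of maximal length). -/
open Classical in
noncomputable def w0 (cs : CoxeterSystem M W) (J : Set B) : W :=
  if h : ∃ w ∈ parabolic cs J, ∀ u ∈ parabolic cs J, cs.length u ≤ cs.length w
  then h.choose else 1

/-- The right descent set of `w`, as a subset of `B`. -/
def rightDescents (cs : CoxeterSystem M W) (w : W) : Set B :=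
  {i | cs.IsRightDescent w i}

/- `μ` is the Möbius function of the subposet `A` of the order `le`. -/
open Classical in
def IsMobiusOn {α : Type*} (le : α → α → Prop) (A : Set α) (μ : α → α → ℤ) : Prop :=
  ∀ a ∈ A, ∀ b ∈ A, le a b →
    (∑ᶠ t ∈ {t | t ∈ A ∧ le a t ∧ le t b}, μ a t) = if a = b then 1 else 0

/-- The length of the longest element of the standard parabolic subgroup `W_J` of the
Coxeter group of type `Aₙ`. -/
noncomputable def lenA (n : ℕ) (J : Finset (Fin n)) : ℕ :=
  (CoxeterMatrix.Aₙ n).toCoxeterSystem.length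
    (w0 (CoxeterMatrix.Aₙ n).toCoxeterSystem (↑J : Set (Fin n)))

/-- The modified characteristic polynomial `χ̂_{Aₙ}(q) = Σ_{J ⊆ S} (-1)^|J| q^(ℓ(w0(J)))`
of the Coxeter group of type `Aₙ` under the left weak order (so `χ̂_{A₀} = 1`). -/
noncomputable def chiA (n : ℕ) : Polynomial ℤ :=
  ∑ J : Finset (Fin n), (-1 : Polynomial ℤ) ^ J.card * X ^ lenA n J

/-! ### Runs of consecutive integers and the resulting polynomial recurrence -/

/-- The length of the longest run of consecutive elements of `J` ending at `n - 1`. -/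
def trailingRun (J : Finset ℕ) : ℕ → ℕ
  | 0 => 0
  | n + 1 => if n ∈ J then trailingRun J n + 1 else 0

/-- The sum of `trailingRun J` over the initial segments of `{0, …, n - 1}`. -/
def runSum (J : Finset ℕ) (n : ℕ) : ℕ :=
  ∑ k ∈ Finset.range n, trailingRun J (k + 1)

theorem runSum_succ (J : Finset ℕ) (n : ℕ) :
    runSum J (n + 1) = runSum J n + trailingRun J (n + 1) :=
  Finset.sum_range_succ _ _

theorem trailingRun_congr {J K : Finset ℕ} {n : ℕ} (h : ∀ i < n, i ∈ J ↔ i ∈ K) :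
    trailingRun J n = trailingRun K n := by
  induction n with
  | zero => rfl
  | succ n ih =>
    simp only [trailingRun, h n n.lt_succ_self, ih fun i hi => h i (hi.trans n.lt_succ_self)]

theorem runSum_congr {J K : Finset ℕ} {n : ℕ} (h : ∀ i < n, i ∈ J ↔ i ∈ K) :
    runSum J n = runSum K n :=
  Finset.sum_congr rfl fun k hk => trailingRun_congr fun i hi =>
    h i (by have := Finset.mem_range.1 hk; omega)

theorem trailingRun_le (J : Finset ℕ) (n : ℕ) : trailingRun J n ≤ n := by
  induction n with
  | zero => exact le_rfl
  | succ n ih => simp only [trailingRun]; split_ifs <;> omega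

theorem le_trailingRun_iff {J : Finset ℕ} {a j n : ℕ} (h : a + j = n) :
    j ≤ trailingRun J n ↔ ∀ i, a ≤ i → i < n → i ∈ J := by
  induction n generalizing a j with
  | zero => simp; omega
  | succ n ih =>
    obtain _ | j := j
    · simp; omega
    · have := ih (a := a) (j := j) (by omega)
      simp only [trailingRun]
      split_ifs with hn
      · rw [Nat.add_le_add_iff_right, this]
        refine ⟨fun H i hi hin => ?_, fun H i hi hin => H i hi (by omega)⟩
        obtain hlt | rfl := Nat.lt_succ_iff_lt_or_eq.1 hin
        exacts [H i hi hlt, hn]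
      · simp only [Nat.le_zero, Nat.succ_ne_zero, false_iff]
        exact fun H => hn (H n (by omega) n.lt_succ_self)

/-- The signed generating polynomial of `runSum` over the subsets of `{0, …, n - 1}`. -/
noncomputable def runPoly (n : ℕ) : Polynomial ℤ :=
  ∑ J ∈ (Finset.range n).powerset, (-1 : Polynomial ℤ) ^ J.card * X ^ runSum J n

/-- The part of `runPoly n` coming from the subsets with trailing run of length `m`. -/
noncomputable def runPolyPart (n m : ℕ) : Polynomial ℤ :=
  ∑ J ∈ (Finset.range n).powerset,
    if trailingRun J n = m then (-1 : Polynomial ℤ) ^ J.card * X ^ runSum J n else 0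

theorem runPoly_eq_sum (n : ℕ) :
    runPoly n = ∑ m ∈ Finset.range (n + 1), runPolyPart n m := by
  unfold runPoly runPolyPart
  rw [Finset.sum_comm]
  refine Finset.sum_congr rfl fun J _ => ?_
  rw [Finset.sum_ite_eq, if_pos]
  exact Finset.mem_range.2 (Nat.lt_succ_of_le (trailingRun_le J n))

theorem runPolyPart_succ_zero (n : ℕ) : runPolyPart (n + 1) 0 = runPoly n := by
  unfold runPolyPart runPoly
  rw [Finset.range_add_one, Finset.sum_powerset_insert Finset.notMem_range_self]
  simp only [trailingRun, Finset.mem_insert_self, if_true, Nat.succ_ne_zero, if_false,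
    Finset.sum_const_zero, add_zero]
  refine Finset.sum_congr rfl fun J hJ => ?_
  have hn : n ∉ J := fun h => Finset.notMem_range_self (Finset.mem_powerset.1 hJ h)
  simp [hn, runSum_succ, trailingRun]

theorem runPolyPart_succ_succ (n m : ℕ) :
    runPolyPart (n + 1) (m + 1) = -X ^ (m + 1) * runPolyPart n m := by
  unfold runPolyPart
  rw [Finset.range_add_one, Finset.sum_powerset_insert Finset.notMem_range_self,
    Finset.sum_eq_zero, zero_add, Finset.mul_sum]
  · refine Finset.sum_congr rfl fun J hJ => ?_
    have hn : n ∉ J := fun h => Finset.notMem_range_self (Finset.mem_powerset.1 hJ h)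
    have hJ' : ∀ i < n, i ∈ insert n J ↔ i ∈ J := fun i hi => by simp [hi.ne]
    simp only [trailingRun, Finset.mem_insert_self, if_true, runSum_succ, trailingRun_congr hJ',
      runSum_congr hJ', Finset.card_insert_of_notMem hn, Nat.add_right_cancel_iff]
    split_ifs with h
    · rw [h]; ring
    · simp
  · intro J hJ
    have hn : n ∉ J := fun h => Finset.notMem_range_self (Finset.mem_powerset.1 hJ h)
    simp [hn, trailingRun]

theorem runPolyPart_self (n : ℕ) :
    runPolyPart n n = (-1 : Polynomial ℤ) ^ n * X ^ (n + 1).choose 2 := by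
  induction n with
  | zero => simp [runPolyPart, trailingRun, runSum]
  | succ n ih =>
    rw [runPolyPart_succ_succ, ih, Nat.choose_succ_succ' (n + 1) 1, Nat.choose_one_right]
    ring

theorem runPolyPart_add (n m : ℕ) :
    runPolyPart (n + m + 1) m =
      runPoly n * ((-1 : Polynomial ℤ) ^ m * X ^ (m + 1).choose 2) := by
  induction m with
  | zero => simp [runPolyPart_succ_zero]
  | succ m ih =>
    rw [← add_assoc n m 1, runPolyPart_succ_succ, ih, Nat.choose_succ_succ' (m + 1) 1,
      Nat.choose_one_right]
    ring

theorem runPoly_convolution (n : ℕ) :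
    ∑ p ∈ Finset.HasAntidiagonal.antidiagonal n,
        runPoly p.1 * ((-1 : Polynomial ℤ) ^ p.2 * X ^ p.2.choose 2) =
      (-1 : Polynomial ℤ) ^ n * X ^ (n + 1).choose 2 := by
  rw [← Finset.Nat.sum_antidiagonal_swap, Finset.Nat.sum_antidiagonal_eq_sum_range_succ_mk,
    Finset.sum_range_succ']
  simp only [Prod.fst_swap, Prod.snd_swap, Nat.sub_zero, pow_zero, Nat.choose_zero_succ, mul_one]
  rw [runPoly_eq_sum n, Finset.sum_range_succ, runPolyPart_self, ← add_assoc,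
    ← Finset.sum_add_distrib, Finset.sum_eq_zero, zero_add]
  intro m hm
  obtain ⟨k, rfl⟩ := Nat.exists_eq_add_of_lt (Finset.mem_range.1 hm)
  rw [show m + k + 1 - (m + 1) = k by omega, add_comm m k, runPolyPart_add]
  ring

/-! ### Sequences satisfying the braid relations of type `A` -/

section Braid

variable {G : Type*} [Group G]

/-- The first `n` terms of `S` satisfy the Coxeter relations of type `A`. -/
structure IsBraidSequence (n : ℕ) (S : ℕ → G) : Prop where
  mul_self : ∀ i < n, S i * S i = 1
  commute : ∀ i j, i + 1 < j → j < n → Commute (S i) (S j)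
  braid : ∀ i, i + 1 < n → S (i + 1) * S i * S (i + 1) = S i * S (i + 1) * S i

/-- The descending product `S (a + j - 1) ⋯ S (a + 1) * S a`. -/
def descProd (S : ℕ → G) (a : ℕ) : ℕ → G
  | 0 => 1
  | j + 1 => S (a + j) * descProd S a j

theorem descProd_succ' (S : ℕ → G) (a j : ℕ) :
    descProd S a (j + 1) = descProd S (a + 1) j * S a := by
  induction j with
  | zero => simp [descProd]
  | succ j ih =>
    rw [descProd, ih, descProd, show a + 1 + j = a + (j + 1) by omega, mul_assoc]

namespace IsBraidSequence

variable {n : ℕ} {S : ℕ → G}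

theorem commute_descProd (hS : IsBraidSequence n S) {i a j : ℕ} (hi : i < n) (hj : a + j ≤ n)
    (h : i + 1 < a ∨ a + j < i) : Commute (S i) (descProd S a j) := by
  induction j with
  | zero => exact Commute.one_right _
  | succ j ih =>
    refine Commute.mul_right ?_ (ih (by omega) (by omega))
    obtain h | h := h
    · exact hS.commute _ _ (by omega) (by omega)
    · exact (hS.commute _ _ (by omega) hi).symm

theorem descProd_mul (hS : IsBraidSequence n S) {i a j : ℕ} (hj : a + j ≤ n)
    (hai : a ≤ i) (hij : i + 1 < a + j) :
    descProd S a j * S (i + 1) = S i * descProd S a j := by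
  induction j with
  | zero => omega
  | succ j ih =>
    obtain h | h : i + 1 < a + j ∨ a + j = i + 1 := by omega
    · rw [descProd, mul_assoc, ih (by omega) h, ← mul_assoc, ← mul_assoc,
        (hS.commute i (a + j) h (by omega)).eq]
    · obtain _ | j := j
      · omega
      · have hc := hS.commute_descProd (i := i + 1) (a := a) (j := j) (by omega) (by omega)
          (by omega)
        rw [descProd, descProd, h, show a + j = i by omega, mul_assoc, mul_assoc, ← hc.eq,
          ← mul_assoc, ← mul_assoc, hS.braid i (by omega)]
        simp only [mul_assoc]

end IsBraidSequence

/-- The subgroup generated by the `S i` with `i ∈ J` and `i < k`. -/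
def initialParabolic (S : ℕ → G) (J : Finset ℕ) (k : ℕ) : Subgroup G :=
  Subgroup.closure (S '' {i | i ∈ J ∧ i < k})

theorem mem_initialParabolic {S : ℕ → G} {J : Finset ℕ} {i k : ℕ} (hi : i ∈ J) (hik : i < k) :
    S i ∈ initialParabolic S J k :=
  Subgroup.subset_closure ⟨i, ⟨hi, hik⟩, rfl⟩

theorem initialParabolic_mono (S : ℕ → G) (J : Finset ℕ) {k l : ℕ} (h : k ≤ l) :
    initialParabolic S J k ≤ initialParabolic S J l :=
  Subgroup.closure_mono (Set.image_mono fun _ hi => ⟨hi.1, hi.2.trans_le h⟩)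

theorem initialParabolic_zero (S : ℕ → G) (J : Finset ℕ) : initialParabolic S J 0 = ⊥ := by
  simp [initialParabolic]

theorem descProd_mem {S : ℕ → G} {J : Finset ℕ} {a j k : ℕ} (h : a + j ≤ k)
    (hJ : ∀ i, a ≤ i → i < a + j → i ∈ J) : descProd S a j ∈ initialParabolic S J k := by
  induction j with
  | zero => exact one_mem _
  | succ j ih =>
    exact mul_mem (mem_initialParabolic (hJ _ (by omega) (by omega)) (by omega))
      (ih (by omega) fun i hi hij => hJ i hi (by omega))

/-- Coset decomposition of `initialParabolic S J (k + 1)` modulo `initialParabolic S J k`. -/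
theorem IsBraidSequence.exists_eq_mul_descProd {n : ℕ} {S : ℕ → G} (hS : IsBraidSequence n S)
    {J : Finset ℕ} {k : ℕ} (hk : k < n) {w : G} (hw : w ∈ initialParabolic S J (k + 1)) :
    ∃ u ∈ initialParabolic S J k, ∃ a j, a + j = k + 1 ∧ (∀ i, a ≤ i → i < k + 1 → i ∈ J) ∧
      w = u * descProd S a j := by
  have key : ∀ x y, y ∈ S '' {i | i ∈ J ∧ i < k + 1} →
      (∃ u ∈ initialParabolic S J k, ∃ a j, a + j = k + 1 ∧
        (∀ i, a ≤ i → i < k + 1 → i ∈ J) ∧ x = u * descProd S a j) →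
      ∃ u ∈ initialParabolic S J k, ∃ a j, a + j = k + 1 ∧
        (∀ i, a ≤ i → i < k + 1 → i ∈ J) ∧ x * y = u * descProd S a j := by
    rintro _ _ ⟨i, ⟨hiJ, hik⟩, rfl⟩ ⟨u, hu, a, j, haj, hJ, rfl⟩
    obtain h | h | h | h : i + 1 < a ∨ i + 1 = a ∨ i = a ∨ a < i := by omega
    · refine ⟨u * S i, mul_mem hu (mem_initialParabolic hiJ (by omega)), a, j, haj, hJ, ?_⟩
      rw [mul_assoc, mul_assoc,
        (hS.commute_descProd (by omega) (by omega) (Or.inl h)).eq]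
    · refine ⟨u, hu, i, j + 1, by omega, fun l hl hlk => ?_, ?_⟩
      · obtain rfl | h' := hl.eq_or_lt
        exacts [hiJ, hJ l (by omega) hlk]
      · rw [descProd_succ', h, mul_assoc]
    · subst h
      obtain _ | j := j
      · omega
      · refine ⟨u, hu, i + 1, j, by omega, fun l hl hlk => hJ l (by omega) hlk, ?_⟩
        rw [descProd_succ', mul_assoc, mul_assoc, hS.mul_self i (by omega), mul_one]
    · obtain _ | i := i
      · omega
      · refine ⟨u * S i, mul_mem hu (mem_initialParabolic (hJ i (by omega) (by omega))
          (by omega)), a, j, haj, hJ, ?_⟩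
        rw [mul_assoc, mul_assoc, hS.descProd_mul (by omega) (by omega) (by omega)]
  induction hw using Subgroup.closure_induction_right with
  | one => exact ⟨1, one_mem _, k + 1, 0, rfl, fun i hi hik => by omega, by simp [descProd]⟩
  | mul_right x hx y hy ih => exact key x y hy ih
  | mul_inv_cancel x hx y hy ih =>
    have hinv : y⁻¹ = y := by
      obtain ⟨i, ⟨-, hi⟩, rfl⟩ := hy
      exact inv_eq_of_mul_eq_one_right (hS.mul_self i (by omega))
    rw [hinv]
    exact key x y hy ih

end Braid

/-! ### Inversions of permutations of `ℕ` -/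

/-- The adjacent transposition exchanging `i` and `i + 1`. -/
def adjSwap (i : ℕ) : Equiv.Perm ℕ := Equiv.swap i (i + 1)

theorem adjSwap_apply (i x : ℕ) :
    adjSwap i x = if x = i then i + 1 else if x = i + 1 then i else x :=
  Equiv.swap_apply_def _ _ _

theorem adjSwap_adjSwap (i x : ℕ) : adjSwap i (adjSwap i x) = x :=
  Equiv.swap_apply_self _ _ _

theorem isBraidSequence_adjSwap (n : ℕ) : IsBraidSequence n adjSwap where
  mul_self i _ := Equiv.swap_mul_self _ _
  commute i j h _ := by
    ext x
    simp only [Equiv.Perm.mul_apply, adjSwap_apply]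
    grind
  braid i _ := by
    ext x
    simp only [Equiv.Perm.mul_apply, adjSwap_apply]
    grind

/-- The inversions of `σ` among the pairs of elements of `{0, …, N - 1}`. -/
def inversions (N : ℕ) (σ : Equiv.Perm ℕ) : Finset (ℕ × ℕ) :=
  (Finset.range N ×ˢ Finset.range N).filter fun p => p.1 < p.2 ∧ σ p.2 < σ p.1

theorem mem_inversions {N : ℕ} {σ : Equiv.Perm ℕ} {p : ℕ × ℕ} :
    p ∈ inversions N σ ↔ (p.1 < N ∧ p.2 < N) ∧ p.1 < p.2 ∧ σ p.2 < σ p.1 := by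
  simp [inversions]

theorem card_inversions_one (N : ℕ) : (inversions N 1).card = 0 := by
  rw [Finset.card_eq_zero, Finset.eq_empty_iff_forall_notMem]
  intro p hp
  have := mem_inversions.1 hp
  simp only [Equiv.Perm.one_apply] at this
  omega

theorem card_inversions_mul_adjSwap {N i : ℕ} {σ : Equiv.Perm ℕ} (hi : i + 1 < N)
    (h : σ i < σ (i + 1)) :
    (inversions N (σ * adjSwap i)).card = (inversions N σ).card + 1 := by
  have hmem : (i, i + 1) ∈ inversions N (σ * adjSwap i) := by
    rw [mem_inversions]
    simp only [Equiv.Perm.mul_apply, adjSwap_apply]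
    grind
  rw [← Finset.card_erase_add_one hmem, Nat.add_right_cancel_iff]
  refine Finset.card_nbij' (fun p => (adjSwap i p.1, adjSwap i p.2))
    (fun p => (adjSwap i p.1, adjSwap i p.2)) ?_ ?_ ?_ ?_
  · rintro ⟨a, b⟩ hp
    simp only [Finset.mem_coe, Finset.mem_erase, mem_inversions, Equiv.Perm.mul_apply,
      ne_eq, Prod.mk.injEq] at hp ⊢
    have ha := adjSwap_apply i a
    have hb := adjSwap_apply i b
    grind
  · rintro ⟨a, b⟩ hp
    simp only [Finset.mem_coe, Finset.mem_erase, mem_inversions, Equiv.Perm.mul_apply,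
      adjSwap_adjSwap, ne_eq, Prod.mk.injEq] at hp ⊢
    have ha := adjSwap_apply i a
    have hb := adjSwap_apply i b
    grind
  · rintro ⟨a, b⟩ -
    simp [adjSwap]
  · rintro ⟨a, b⟩ -
    simp [adjSwap]

theorem card_inversions_mul_adjSwap_le {N i : ℕ} (σ : Equiv.Perm ℕ) (hi : i + 1 < N) :
    (inversions N (σ * adjSwap i)).card ≤ (inversions N σ).card + 1 := by
  obtain h | h | h := lt_trichotomy (σ i) (σ (i + 1))
  · exact (card_inversions_mul_adjSwap hi h).le
  · exact absurd (σ.injective h) (by omega)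
  · have := card_inversions_mul_adjSwap (σ := σ * adjSwap i) hi (by simpa [adjSwap] using h)
    rw [mul_assoc, (isBraidSequence_adjSwap (i + 1)).mul_self i i.lt_succ_self, mul_one] at this
    omega

theorem descProd_adjSwap_apply_of_lt {a x : ℕ} (j : ℕ) (h : x < a) :
    descProd adjSwap a j x = x := by
  induction j with
  | zero => rfl
  | succ j ih =>
    rw [descProd, Equiv.Perm.mul_apply, ih, adjSwap_apply]
    grind

theorem descProd_adjSwap_apply_self (a j : ℕ) : descProd adjSwap a j a = a + j := by
  induction j with
  | zero => rfl
  | succ j ih => rw [descProd, Equiv.Perm.mul_apply, ih, adjSwap_apply, if_pos rfl]; rfl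

theorem apply_eq_of_mem_initialParabolic {J : Finset ℕ} {k x : ℕ} {σ : Equiv.Perm ℕ}
    (hσ : σ ∈ initialParabolic adjSwap J k) (hx : k < x) : σ x = x := by
  have : initialParabolic adjSwap J k ≤ MulAction.stabilizer (Equiv.Perm ℕ) x := by
    refine (Subgroup.closure_le _).2 ?_
    rintro _ ⟨i, ⟨-, hi⟩, rfl⟩
    rw [SetLike.mem_coe, MulAction.mem_stabilizer_iff, Equiv.Perm.smul_def, adjSwap_apply]
    grind
  exact this hσ

theorem exists_card_inversions_eq_runSum (J : Finset ℕ) (n : ℕ) :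
    ∀ k ≤ n, ∃ σ ∈ initialParabolic adjSwap J k, (inversions (n + 1) σ).card = runSum J k := by
  intro k hk
  induction k with
  | zero => exact ⟨1, one_mem _, by simp [card_inversions_one, runSum]⟩
  | succ k ih =>
    obtain ⟨σ, hσ, hc⟩ := ih (by omega)
    have hrun : ∀ a j, a + j = k + 1 → j ≤ trailingRun J (k + 1) →
        (inversions (n + 1) (σ * descProd adjSwap a j)).card = runSum J k + j := by
      intro a j haj hj
      induction j generalizing a with
      | zero => simpa [descProd] using hc
      | succ j ihj =>
        have hσk : σ (k + 1) = k + 1 := apply_eq_of_mem_initialParabolic hσ k.lt_succ_self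
        rw [descProd_succ', ← mul_assoc, card_inversions_mul_adjSwap (by omega),
          ihj (a + 1) (by omega) (by omega), add_assoc]
        rw [Equiv.Perm.mul_apply, Equiv.Perm.mul_apply, descProd_adjSwap_apply_self,
          descProd_adjSwap_apply_of_lt j a.lt_succ_self, show a + 1 + j = k + 1 by omega, hσk]
        by_contra! hlt
        obtain heq | hgt := hlt.eq_or_lt
        · have := σ.injective (hσk.trans heq)
          omega
        · have := σ.injective (apply_eq_of_mem_initialParabolic hσ (x := σ a) (by omega))
          omega
    have hle := trailingRun_le J (k + 1)
    have haj : k + 1 - trailingRun J (k + 1) + trailingRun J (k + 1) = k + 1 := by omega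
    refine ⟨σ * descProd adjSwap (k + 1 - trailingRun J (k + 1)) (trailingRun J (k + 1)),
      mul_mem (initialParabolic_mono _ _ k.le_succ hσ) (descProd_mem haj.le ?_), ?_⟩
    · rw [haj]
      exact (le_trailingRun_iff haj).1 le_rfl
    · rw [hrun _ _ haj le_rfl, runSum_succ]

/-! ### The Coxeter group of type `A` -/

section TypeA

set_option linter.deprecated false

variable (n : ℕ)

/-- The simple reflections of type `Aₙ`, extended by `1` to a sequence indexed by `ℕ`. -/
noncomputable def simpleSeq (i : ℕ) : (CoxeterMatrix.Aₙ n).Group :=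
  if h : i < n then (CoxeterMatrix.Aₙ n).toCoxeterSystem.simple ⟨i, h⟩ else 1

theorem simpleSeq_val (i : Fin n) :
    simpleSeq n i = (CoxeterMatrix.Aₙ n).toCoxeterSystem.simple i := by
  simp [simpleSeq]

theorem isBraidSequence_simpleSeq : IsBraidSequence n (simpleSeq n) where
  mul_self i hi := by
    rw [simpleSeq, dif_pos hi]
    exact CoxeterSystem.simple_mul_simple_self _ _
  commute i j hij hj := by
    have hi : i < n := by omega
    have h := (CoxeterMatrix.Aₙ n).toCoxeterSystem.simple_mul_simple_pow ⟨i, hi⟩ ⟨j, hj⟩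
    have hM : (CoxeterMatrix.Aₙ n) ⟨i, hi⟩ ⟨j, hj⟩ = 2 := by
      change (if _ then _ else _) = 2
      rw [if_neg (by simp; omega), if_neg (by simp; omega)]
    rw [hM, pow_two, mul_eq_one_iff_eq_inv, mul_inv_rev, CoxeterSystem.inv_simple,
      CoxeterSystem.inv_simple] at h
    rw [simpleSeq, simpleSeq, dif_pos hi, dif_pos hj]
    exact h
  braid i hi := by
    have hi' : i < n := by omega
    have h := (CoxeterMatrix.Aₙ n).toCoxeterSystem.simple_mul_simple_pow ⟨i, hi'⟩ ⟨i + 1, hi⟩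
    have hM : (CoxeterMatrix.Aₙ n) ⟨i, hi'⟩ ⟨i + 1, hi⟩ = 3 := by
      change (if _ then _ else _) = 3
      rw [if_neg (by simp), if_pos (by simp)]
    simp only [simpleSeq, dif_pos hi, dif_pos hi']
    generalize (CoxeterMatrix.Aₙ n).toCoxeterSystem = cs at h ⊢
    have h' : cs.simple ⟨i, hi'⟩ * cs.simple ⟨i + 1, hi⟩ * cs.simple ⟨i, hi'⟩ *
        (cs.simple ⟨i + 1, hi⟩ * cs.simple ⟨i, hi'⟩ * cs.simple ⟨i + 1, hi⟩) = 1 := by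
      rw [← h, hM, pow_succ, pow_two]
      simp only [mul_assoc]
    rw [eq_inv_of_mul_eq_one_left h']
    simp only [mul_inv_rev, CoxeterSystem.inv_simple, mul_assoc]

theorem isLiftable_adjSwap :
    (CoxeterMatrix.Aₙ n).IsLiftable fun i : Fin n => adjSwap i := by
  have hS := isBraidSequence_adjSwap n
  have hcomm : ∀ i j : ℕ, i < n → j < n → i ≠ j → j + 1 ≠ i → i + 1 ≠ j →
      (adjSwap i * adjSwap j) ^ 2 = 1 := by
    intro i j hi hj h0 h1 h2
    have hc : Commute (adjSwap i) (adjSwap j) := by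
      obtain h | h : i + 1 < j ∨ j + 1 < i := by omega
      exacts [hS.commute i j h hj, (hS.commute j i h hi).symm]
    rw [hc.mul_pow, pow_two, pow_two, hS.mul_self i hi, hS.mul_self j hj, one_mul]
  have hbraid : ∀ i j : ℕ, j + 1 = i ∨ i + 1 = j → (adjSwap i * adjSwap j) ^ 3 = 1 := by
    intro i j h
    ext x
    simp only [pow_succ, pow_zero, one_mul, Equiv.Perm.mul_apply, adjSwap_apply,
      Equiv.Perm.one_apply]
    obtain rfl | rfl := h <;> grind
  intro i j
  change (adjSwap i * adjSwap j) ^ (if i = j then 1 else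
    if (j : ℕ) + 1 = i ∨ (i : ℕ) + 1 = j then 3 else 2) = 1
  split_ifs with h1 h2
  · rw [h1, pow_one, hS.mul_self _ j.2]
  · exact hbraid _ _ h2
  · rw [not_or] at h2
    exact hcomm _ _ i.2 j.2 (fun h => h1 (Fin.ext h)) h2.1 h2.2

/-- The permutation action of the Coxeter group of type `Aₙ` on `ℕ`. -/
noncomputable def toPermNat : (CoxeterMatrix.Aₙ n).Group →* Equiv.Perm ℕ :=
  (CoxeterMatrix.Aₙ n).toCoxeterSystem.lift ⟨_, isLiftable_adjSwap n⟩

theorem toPermNat_simple (i : Fin n) :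
    toPermNat n ((CoxeterMatrix.Aₙ n).toCoxeterSystem.simple i) = adjSwap i :=
  CoxeterSystem.lift_apply_simple _ (isLiftable_adjSwap n) i

theorem card_inversions_le_length (w : (CoxeterMatrix.Aₙ n).Group) :
    (inversions (n + 1) (toPermNat n w)).card ≤
      (CoxeterMatrix.Aₙ n).toCoxeterSystem.length w := by
  obtain ⟨ω, hω, rfl⟩ := (CoxeterMatrix.Aₙ n).toCoxeterSystem.exists_isReduced w
  rw [hω.eq]
  clear hω
  induction ω using List.reverseRecOn with
  | nil => simp [card_inversions_one]
  | append_singleton ω i ih =>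
    rw [CoxeterSystem.wordProd_append, CoxeterSystem.wordProd_singleton, map_mul,
      toPermNat_simple, List.length_append, List.length_singleton]
    exact (card_inversions_mul_adjSwap_le _ (by omega)).trans (Nat.add_le_add_right ih 1)

theorem length_simpleSeq_le (i : ℕ) :
    (CoxeterMatrix.Aₙ n).toCoxeterSystem.length (simpleSeq n i) ≤ 1 := by
  unfold simpleSeq
  split_ifs with h
  · exact (CoxeterSystem.length_simple _ _).le
  · simp

theorem length_descProd_le (a j : ℕ) :
    (CoxeterMatrix.Aₙ n).toCoxeterSystem.length (descProd (simpleSeq n) a j) ≤ j := by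
  induction j with
  | zero => simp [descProd]
  | succ j ih =>
    have h1 := CoxeterSystem.length_mul_le (CoxeterMatrix.Aₙ n).toCoxeterSystem
      (simpleSeq n (a + j)) (descProd (simpleSeq n) a j)
    have h2 := length_simpleSeq_le n (a + j)
    rw [descProd]
    omega

theorem length_le_runSum (J : Finset ℕ) {k : ℕ} (hk : k ≤ n) :
    ∀ w ∈ initialParabolic (simpleSeq n) J k,
      (CoxeterMatrix.Aₙ n).toCoxeterSystem.length w ≤ runSum J k := by
  induction k with
  | zero =>
    intro w hw
    rw [initialParabolic_zero, Subgroup.mem_bot] at hw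
    simp [hw]
  | succ k ih =>
    intro w hw
    obtain ⟨u, hu, a, j, haj, hJ, rfl⟩ :=
      (isBraidSequence_simpleSeq n).exists_eq_mul_descProd hk hw
    have h1 := CoxeterSystem.length_mul_le (CoxeterMatrix.Aₙ n).toCoxeterSystem
      u (descProd (simpleSeq n) a j)
    have h2 := length_descProd_le n a j
    have h3 := ih (by omega) u hu
    have h4 := (le_trailingRun_iff haj).2 hJ
    rw [runSum_succ]
    omega

theorem map_toPermNat_initialParabolic (J : Finset ℕ) :
    (initialParabolic (simpleSeq n) J n).map (toPermNat n) = initialParabolic adjSwap J n := by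
  rw [initialParabolic, MonoidHom.map_closure, Set.image_image, initialParabolic]
  congr 1
  refine Set.image_congr fun i hi => ?_
  rw [simpleSeq, dif_pos hi.2, toPermNat_simple]

theorem parabolic_eq_initialParabolic (J : Finset (Fin n)) :
    parabolic (CoxeterMatrix.Aₙ n).toCoxeterSystem (↑J : Set (Fin n)) =
      initialParabolic (simpleSeq n) (J.map Fin.valEmbedding) n := by
  rw [parabolic, initialParabolic]
  congr 1
  ext w
  constructor
  · rintro ⟨i, hi, rfl⟩
    exact ⟨i, ⟨Finset.mem_map_of_mem Fin.valEmbedding hi, i.2⟩, simpleSeq_val n i⟩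
  · rintro ⟨_, ⟨hi, -⟩, rfl⟩
    obtain ⟨i, hiJ, rfl⟩ := Finset.mem_map.1 hi
    exact ⟨i, hiJ, (simpleSeq_val n i).symm⟩

theorem lenA_eq_runSum (J : Finset (Fin n)) :
    lenA n J = runSum (J.map Fin.valEmbedding) n := by
  have hle := length_le_runSum n (J.map Fin.valEmbedding) le_rfl
  obtain ⟨σ, hσ, hc⟩ := exists_card_inversions_eq_runSum (J.map Fin.valEmbedding) n n le_rfl
  rw [← map_toPermNat_initialParabolic] at hσ
  obtain ⟨w, hw, rfl⟩ := hσ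
  have hge := hc ▸ card_inversions_le_length n w
  rw [SetLike.mem_coe] at hw
  rw [← parabolic_eq_initialParabolic] at hle hw
  have hex : ∃ w ∈ parabolic (CoxeterMatrix.Aₙ n).toCoxeterSystem (↑J : Set (Fin n)),
      ∀ u ∈ parabolic (CoxeterMatrix.Aₙ n).toCoxeterSystem (↑J : Set (Fin n)),
        (CoxeterMatrix.Aₙ n).toCoxeterSystem.length u ≤
          (CoxeterMatrix.Aₙ n).toCoxeterSystem.length w :=
    ⟨w, hw, fun u hu => (hle u hu).trans hge⟩
  rw [lenA, w0, dif_pos hex]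
  exact le_antisymm (hle _ hex.choose_spec.1) (hge.trans (hex.choose_spec.2 w hw))

theorem chiA_eq_runPoly : chiA n = runPoly n := by
  unfold chiA runPoly
  refine Finset.sum_bij (fun J _ => J.map Fin.valEmbedding) ?_ ?_ ?_ ?_
  · intro J _
    rw [Finset.mem_powerset]
    intro i hi
    obtain ⟨i, -, rfl⟩ := Finset.mem_map.1 hi
    exact Finset.mem_range.2 i.2
  · exact fun J _ K _ h => Finset.map_injective _ h
  · intro K hK
    refine ⟨Finset.univ.filter fun i : Fin n => (i : ℕ) ∈ K, Finset.mem_univ _, ?_⟩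
    ext i
    simp only [Finset.mem_map, Finset.mem_filter, Finset.mem_univ, true_and,
      Fin.valEmbedding_apply]
    exact ⟨fun ⟨_, h, h'⟩ => h' ▸ h,
      fun h => ⟨⟨i, Finset.mem_range.1 (Finset.mem_powerset.1 hK h)⟩, h, rfl⟩⟩
  · intro J _
    rw [lenA_eq_runSum, Finset.card_map]

end TypeA

/-- `(Σ_{n≥0} χ̂_{Aₙ}(q) xⁿ) · (Σ_{n≥0} (-1)ⁿ q^(C(n,2)) xⁿ) = Σ_{n≥0} (-1)ⁿ q^(C(n+1,2)) xⁿ`. -/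
theorem genfun_chiA :
    (PowerSeries.mk fun n => chiA n) *
        (PowerSeries.mk fun n => (-1 : Polynomial ℤ) ^ n * X ^ n.choose 2) =
      PowerSeries.mk fun n => (-1 : Polynomial ℤ) ^ n * X ^ (n + 1).choose 2 := by
  ext1 n
  simp only [PowerSeries.coeff_mul, PowerSeries.coeff_mk, chiA_eq_runPoly]
  exact runPoly_convolution n

end CoxeterCharPoly
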